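/- arXiv:2309.13598 — 4 statements merged into one kernel-verified Lean document; each statement's English description precedes it below -/
import Mathlib

section
/- For every integer k ≥ 3 and every y ∈ ℝ, the k-th posterior central moment μ_k is differentiable at y and the posterior central moments satisfy the recursion μ_{k+1}(y) = σ² · μ_k'(y) + k · μ_{k−1}(y) · μ₂(y). -/
open MeasureTheory Real

/-- A continuous function times a compactly supported integrable function is integrable. -/
theorem integrable_continuous_mul_of_hasCompactSupport
    {p : ℝ → ℝ} (hp : Integrable p) (hp_supp : HasCompactSupport p)
    {f : ℝ → ℝ} (hf : Continuous f) : Integrable (fun x => f x * p x) := by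
  obtain ⟨C, hC⟩ := hp_supp.isCompact.exists_bound_of_continuousOn hf.continuousOn
  refine (hp.norm.const_mul C).mono' (hf.aestronglyMeasurable.mul hp.aestronglyMeasurable) ?_
  refine Filter.Eventually.of_forall fun x => ?_
  by_cases hx : x ∈ tsupport p
  · rw [norm_mul]
    exact mul_le_mul_of_nonneg_right (hC x hx) (norm_nonneg _)
  · simp [image_eq_zero_of_notMem_tsupport hx]

/-- Differentiation under the integral sign against a compactly supported integrable weight, for an
integrand whose derivative in the parameter is jointly continuous. -/
theorem hasDerivAt_integral_mul_of_hasCompactSupport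
    {p : ℝ → ℝ} (hp : Integrable p) (hp_supp : HasCompactSupport p)
    {g g' : ℝ → ℝ → ℝ} (hg : ∀ y, Continuous (g y)) (hg' : Continuous (Function.uncurry g'))
    (hderiv : ∀ y x, HasDerivAt (fun t => g t x) (g' y x) y) (y : ℝ) :
    HasDerivAt (fun t => ∫ x, g t x * p x) (∫ x, g' y x * p x) y := by
  have hint : ∀ {f : ℝ → ℝ}, Continuous f → Integrable (fun x => f x * p x) :=
    integrable_continuous_mul_of_hasCompactSupport hp hp_supp
  obtain ⟨C, hC⟩ := ((isCompact_closedBall y 1).prod hp_supp.isCompact).exists_bound_of_continuousOn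
    hg'.continuousOn
  refine (hasDerivAt_integral_of_dominated_loc_of_deriv_le
    (bound := fun x => C * ‖p x‖) (F' := fun t x => g' t x * p x)
    (Metric.closedBall_mem_nhds y one_pos)
    (Filter.Eventually.of_forall fun t => (hint (hg t)).aestronglyMeasurable)
    (hint (hg y)) (hint (hg'.comp (Continuous.prodMk_right y))).aestronglyMeasurable
    ?_ (hp.norm.const_mul C) ?_).2
  · refine Filter.Eventually.of_forall fun x t ht => ?_
    by_cases hx : x ∈ tsupport p
    · rw [norm_mul]
      exact mul_le_mul_of_nonneg_right (hC (t, x) ⟨ht, hx⟩) (norm_nonneg _)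
    · simp [image_eq_zero_of_notMem_tsupport hx]
  · exact Filter.Eventually.of_forall fun x t _ => (hderiv t x).mul_const (p x)

/-- Derivative of the `k`-th moment about a moving centre `m`, for a convolution kernel `φ` that
satisfies the Gaussian differential equation `φ' t = -t / σ ^ 2 * φ t`. -/
theorem hasDerivAt_integral_sub_pow_mul_gaussian
    {σ : ℝ} {p : ℝ → ℝ} (hp : Integrable p) (hp_supp : HasCompactSupport p)
    {φ : ℝ → ℝ} (hφ : ∀ t, HasDerivAt φ (-t / σ ^ 2 * φ t) t)
    {m m' : ℝ → ℝ} (hm : ∀ y, HasDerivAt m (m' y) y) (hm' : Continuous m') (k : ℕ) (y : ℝ) :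
    HasDerivAt (fun t => ∫ x, (x - m t) ^ k * φ (t - x) * p x)
      (-(k * m' y * ∫ x, (x - m y) ^ (k - 1) * φ (y - x) * p x) +
        ((∫ x, (x - m y) ^ (k + 1) * φ (y - x) * p x) +
          (m y - y) * ∫ x, (x - m y) ^ k * φ (y - x) * p x) / σ ^ 2) y := by
  have hφc : Continuous φ := continuous_iff_continuousAt.2 fun t => (hφ t).continuousAt
  have hmc : Continuous m := continuous_iff_continuousAt.2 fun t => (hm t).continuousAt
  have hint (j : ℕ) : Integrable (fun x => (x - m y) ^ j * φ (y - x) * p x) :=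
    integrable_continuous_mul_of_hasCompactSupport hp hp_supp (by fun_prop)
  have key := hasDerivAt_integral_mul_of_hasCompactSupport hp hp_supp
    (g := fun t x => (x - m t) ^ k * φ (t - x))
    (g' := fun t x => k * (x - m t) ^ (k - 1) * (-m' t) * φ (t - x) +
      (x - m t) ^ k * (-(t - x) / σ ^ 2 * φ (t - x)))
    (fun t => by fun_prop) (by simp only [Function.uncurry_def]; fun_prop)
    (fun t x => by
      have h₁ := ((hm t).const_sub x).fun_pow k
      have h₂ := (hφ (t - x)).comp t ((hasDerivAt_id t).sub_const x)
      simp only [mul_one] at h₂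
      exact h₁.fun_mul h₂) y
  refine key.congr_deriv ?_
  rw [← integral_const_mul, ← integral_const_mul, ← integral_neg,
    ← integral_add (hint _) ((hint _).const_mul _), ← integral_div, ← integral_add]
  · congr 1
    ext x
    ring
  · exact ((hint _).const_mul _).neg
  · exact ((hint _).add ((hint _).const_mul _)).div_const _

/-- For every integer `k ≥ 3` and every `y`, the `k`-th posterior central moment is
differentiable at `y` and `μ_{k+1} y = σ² * μ_k' y + k * μ_{k-1} y * μ₂ y`. -/
theorem central_moment_recursion_univariate
    (σ : ℝ) (hσ : 0 < σ)
    (p : ℝ → ℝ) (hp_meas : Measurable p) (hp_nonneg : ∀ x, 0 ≤ p x)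
    (hp_bdd : ∃ C, ∀ x, p x ≤ C) (hp_supp : HasCompactSupport p)
    (hp_int : ∫ x, p x = 1)
    (φ : ℝ → ℝ)
    (hφ : ∀ t, φ t = (2 * π * σ ^ 2) ^ (-(1 : ℝ) / 2) * Real.exp (-t ^ 2 / (2 * σ ^ 2)))
    (pY : ℝ → ℝ) (hpY : ∀ y, pY y = ∫ x, φ (y - x) * p x)
    (hpY_pos : ∀ y, 0 < pY y)
    (μ₁ : ℝ → ℝ) (hμ₁ : ∀ y, μ₁ y = (∫ x, x * φ (y - x) * p x) / pY y)
    (μ : ℕ → ℝ → ℝ)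
    (hμ : ∀ k, 2 ≤ k → ∀ y, μ k y = (∫ x, (x - μ₁ y) ^ k * φ (y - x) * p x) / pY y) :
    ∀ k : ℕ, 3 ≤ k → ∀ y : ℝ,
      DifferentiableAt ℝ (μ k) y ∧
      μ (k + 1) y = σ ^ 2 * deriv (μ k) y + (k : ℝ) * μ (k - 1) y * μ 2 y := by
  obtain ⟨hσ₂, hpY'⟩ : σ ^ 2 ≠ 0 ∧ ∀ y, pY y ≠ 0 := ⟨by positivity, fun y => (hpY_pos y).ne'⟩
  have hp : Integrable p := .of_integral_ne_zero (by simp [hp_int])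
  have hφ' : ∀ t, HasDerivAt φ (-t / σ ^ 2 * φ t) t := by
    intro t
    rw [funext hφ]
    refine ((((hasDerivAt_id t).fun_pow 2).fun_neg.div_const
      (2 * σ ^ 2)).exp.const_mul _).congr_deriv ?_
    simp
    field_simp
  have hφc : Continuous φ := continuous_iff_continuousAt.2 fun t => (hφ' t).continuousAt
  -- The raw moments are smooth enough for the posterior mean to be continuously differentiable.
  have hraw (j : ℕ) (y : ℝ) := hasDerivAt_integral_sub_pow_mul_gaussian hp hp_supp hφ'
    (fun y => hasDerivAt_const y (0 : ℝ)) continuous_const j y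
  simp only [sub_zero, mul_zero, zero_mul, neg_zero, zero_add, zero_sub] at hraw
  have hrawc (j : ℕ) : Continuous fun y => ∫ x, x ^ j * φ (y - x) * p x :=
    continuous_iff_continuousAt.2 fun y => (hraw j y).continuousAt
  obtain ⟨m', hm', hm'c⟩ : ∃ m' : ℝ → ℝ, (∀ y, HasDerivAt μ₁ (m' y) y) ∧ Continuous m' := by
    have h (y : ℝ) := (hraw 1 y).fun_div (hraw 0 y) (by simpa [← hpY] using hpY' y)
    refine ⟨_, fun y => (h y).congr_of_eventuallyEq (.of_forall fun t => ?_), ?_⟩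
    · simp [hμ₁, hpY]
    · have h₀ := hrawc 0
      have h₁ := hrawc 1
      have h₂ := hrawc 2
      refine Continuous.div (by fun_prop) (by fun_prop) fun y => ?_
      simpa [← hpY] using hpY' y
  have hcentral (j : ℕ) (y : ℝ) :=
    hasDerivAt_integral_sub_pow_mul_gaussian hp hp_supp hφ' hm' hm'c j y
  have hA₁ (y : ℝ) : ∫ x, (x - μ₁ y) ^ 1 * φ (y - x) * p x = 0 := by
    have hint₀ : Integrable fun x => φ (y - x) * p x :=
      integrable_continuous_mul_of_hasCompactSupport hp hp_supp (by fun_prop)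
    have hint₁ : Integrable fun x => x * φ (y - x) * p x :=
      integrable_continuous_mul_of_hasCompactSupport hp hp_supp (by fun_prop)
    simp only [pow_one, sub_mul, mul_assoc] at hint₁ ⊢
    rw [integral_sub hint₁ (hint₀.const_mul _), integral_const_mul, ← hpY, hμ₁,
      div_mul_cancel₀ _ (hpY' y)]
    simp [mul_assoc]
  have hA₀ (y : ℝ) : ∫ x, (x - μ₁ y) ^ 0 * φ (y - x) * p x = pY y := by simp [hpY]
  have hA {j : ℕ} (hj : 2 ≤ j) (y : ℝ) :
      ∫ x, (x - μ₁ y) ^ j * φ (y - x) * p x = μ j y * pY y := by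
    rw [hμ j hj, div_mul_cancel₀ _ (hpY' y)]
  have hpYd (y : ℝ) : HasDerivAt pY ((μ₁ y - y) * pY y / σ ^ 2) y := by
    have h := hcentral 0 y
    simp only [zero_add, hA₁, hA₀] at h
    simpa using h
  -- The first central moment vanishes identically, which identifies the derivative of the mean.
  have hm'_eq (y : ℝ) : m' y = μ 2 y / σ ^ 2 := by
    have h := hcentral 1 y
    simp only [hA₁, Nat.sub_self, Nat.reduceAdd, hA₀, hA le_rfl] at h
    have h0 := h.unique (hasDerivAt_const y 0)
    field_simp at h0 ⊢
    push_cast at h0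
    refine mul_left_cancel₀ (hpY' y) ?_
    linarith
  intro k hk y
  have hd := (hcentral k y).fun_div (hpYd y) (hpY' y)
  simp only [hA (show 2 ≤ k by omega), hA (show 2 ≤ k - 1 by omega),
    hA (show 2 ≤ k + 1 by omega), hm'_eq, mul_div_cancel_right₀ _ (hpY' _)] at hd
  refine ⟨hd.differentiableAt, ?_⟩
  rw [HasDerivAt.deriv (f := μ k) hd]
  have := hpY' y
  field_simp
  ring
end

section
/- For every integer k ≥ 1 and every y ∈ ℝ, the k-th non-central posterior moment m_k is differentiable at y and the non-central posterior moments satisfy the recursion m_{k+1}(y) = σ² · m_k'(y) + m_k(y) · μ₁(y), where m_k(y) = (∫ x^k φ_σ(y−x) p(x) dx) / p_Y(y) and μ₁ = m₁. -/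
open MeasureTheory Real

/-- `|t| exp (-t² / (2σ²))` is bounded by `σ`. -/
lemma abs_mul_exp_neg_sq_le {σ : ℝ} (hσ : 0 < σ) (t : ℝ) :
    |t| * exp (-t ^ 2 / (2 * σ ^ 2)) ≤ σ := by
  have h : |t| / σ ≤ exp (t ^ 2 / (2 * σ ^ 2)) := by
    have h₁ : t ^ 2 / (2 * σ ^ 2) = (|t| / σ) ^ 2 / 2 := by
      rw [div_pow, sq_abs]; field_simp
    rw [h₁]
    nlinarith [add_one_le_exp ((|t| / σ) ^ 2 / 2), sq_nonneg (|t| / σ - 1)]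
  rw [neg_div, exp_neg, ← div_eq_mul_inv, div_le_iff₀ (exp_pos _), mul_comm]
  exact (div_le_iff₀ hσ).mp h

/-- The derivative of a Gaussian kernel of variance `σ²`, up to normalisation. -/
lemma hasDerivAt_const_mul_exp_neg_sq {σ : ℝ} (hσ : 0 < σ) (c t : ℝ) :
    HasDerivAt (fun t ↦ c * exp (-t ^ 2 / (2 * σ ^ 2)))
      (-t / σ ^ 2 * (c * exp (-t ^ 2 / (2 * σ ^ 2)))) t := by
  have h := ((((hasDerivAt_id t).pow 2).neg.div_const (2 * σ ^ 2)).exp).const_mul c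
  refine h.congr_deriv ?_
  simp
  field_simp

/-- Multiplying an integrable kernel weight by a Gaussian kernel preserves integrability. -/
lemma integrable_gaussian_mul {σ : ℝ} (c y : ℝ) {g : ℝ → ℝ} (hg : Integrable g) :
    Integrable fun x ↦ c * exp (-(y - x) ^ 2 / (2 * σ ^ 2)) * g x := by
  refine hg.bdd_mul (c := |c|) (by fun_prop) (.of_forall fun x ↦ ?_)
  rw [norm_mul, norm_eq_abs, norm_of_nonneg (exp_pos _).le]
  refine mul_le_of_le_one_right (abs_nonneg c) (exp_le_one_iff.mpr ?_)
  exact div_nonpos_of_nonpos_of_nonneg (neg_nonpos.mpr (sq_nonneg _)) (by positivity)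

/-- Differentiation of a Gaussian convolution: `σ² (φ * g)' = φ * (x g) - y (φ * g)`. -/
lemma hasDerivAt_integral_gaussian_mul {σ : ℝ} (hσ : 0 < σ) (c : ℝ) {g : ℝ → ℝ}
    (hg : Integrable g) (hxg : Integrable fun x ↦ x * g x) (y : ℝ) :
    HasDerivAt (fun y ↦ ∫ x, c * exp (-(y - x) ^ 2 / (2 * σ ^ 2)) * g x)
      (((∫ x, c * exp (-(y - x) ^ 2 / (2 * σ ^ 2)) * (x * g x)) -
        y * ∫ x, c * exp (-(y - x) ^ 2 / (2 * σ ^ 2)) * g x) / σ ^ 2) y := by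
  have key := (hasDerivAt_integral_of_dominated_loc_of_deriv_le (μ := volume)
    (F := fun y x ↦ c * exp (-(y - x) ^ 2 / (2 * σ ^ 2)) * g x)
    (F' := fun y x ↦ -(y - x) / σ ^ 2 * (c * exp (-(y - x) ^ 2 / (2 * σ ^ 2))) * g x)
    (bound := fun x ↦ |c| / σ * ‖g x‖) (x₀ := y) Filter.univ_mem
    (.of_forall fun z ↦ (integrable_gaussian_mul c z hg).aestronglyMeasurable)
    (integrable_gaussian_mul c y hg)
    (AEStronglyMeasurable.mul (Continuous.aestronglyMeasurable (by fun_prop))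
      hg.aestronglyMeasurable)
    (.of_forall fun x z _ ↦ ?_) (hg.norm.const_mul _)
    (.of_forall fun x z _ ↦ ?_)).2
  · refine key.congr_deriv ?_
    rw [← integral_const_mul, ← integral_sub (integrable_gaussian_mul c y hxg)
      ((integrable_gaussian_mul c y hg).const_mul y), ← integral_div]
    congr 1 with x
    ring
  · rw [norm_mul]
    gcongr
    rw [norm_mul, norm_mul, norm_of_nonneg (exp_pos _).le, norm_div, norm_neg, norm_eq_abs,
      norm_eq_abs c, norm_of_nonneg (sq_nonneg σ)]
    calc |z - x| / σ ^ 2 * (|c| * exp (-(z - x) ^ 2 / (2 * σ ^ 2)))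
        = |c| / σ ^ 2 * (|z - x| * exp (-(z - x) ^ 2 / (2 * σ ^ 2))) := by ring
      _ ≤ |c| / σ ^ 2 * σ := by gcongr; exact abs_mul_exp_neg_sq_le hσ _
      _ = |c| / σ := by field_simp
  · exact ((hasDerivAt_const_mul_exp_neg_sq hσ c (z - x)).comp_sub_const z x).mul_const (g x)

/-- A compactly supported integrable function has integrable moments of all orders. -/
lemma integrable_pow_mul_of_hasCompactSupport {p : ℝ → ℝ} (hp : Integrable p)
    (hsupp : HasCompactSupport p) (k : ℕ) : Integrable fun x ↦ x ^ k * p x := by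
  have h : IntegrableOn (fun x ↦ x ^ k * p x) (tsupport p) :=
    hp.integrableOn.continuousOn_mul (continuous_pow k).continuousOn hsupp
  refine (integrableOn_iff_integrable_of_support_subset ?_).mp h
  exact (Function.support_mul_subset_right _ _).trans (subset_tsupport p)

/-- For every integer `k ≥ 1` and every `y`, the `k`-th non-central posterior moment is
differentiable at `y` and `m_{k+1} y = σ² * m_k' y + m_k y * μ₁ y`, where `μ₁ = m₁`. -/
theorem noncentral_moment_recursion_univariate
    (σ : ℝ) (hσ : 0 < σ)
    (p : ℝ → ℝ) (hp_meas : Measurable p) (hp_nonneg : ∀ x, 0 ≤ p x)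
    (hp_bdd : ∃ C, ∀ x, p x ≤ C) (hp_supp : HasCompactSupport p)
    (hp_int : ∫ x, p x = 1)
    (φ : ℝ → ℝ)
    (hφ : ∀ t, φ t = (2 * π * σ ^ 2) ^ (-(1 : ℝ) / 2) * Real.exp (-t ^ 2 / (2 * σ ^ 2)))
    (pY : ℝ → ℝ) (hpY : ∀ y, pY y = ∫ x, φ (y - x) * p x)
    (hpY_pos : ∀ y, 0 < pY y)
    (m : ℕ → ℝ → ℝ)
    (hm : ∀ k, 1 ≤ k → ∀ y, m k y = (∫ x, x ^ k * φ (y - x) * p x) / pY y) :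
    ∀ k : ℕ, 1 ≤ k → ∀ y : ℝ,
      DifferentiableAt ℝ (m k) y ∧
      m (k + 1) y = σ ^ 2 * deriv (m k) y + m k y * m 1 y := by
  intro k hk y
  have hp : Integrable p := by
    by_contra h
    simp [integral_undef h] at hp_int
  set c : ℝ := (2 * π * σ ^ 2) ^ (-(1 : ℝ) / 2)
  let G : ℕ → ℝ → ℝ := fun k y ↦ ∫ x, c * exp (-(y - x) ^ 2 / (2 * σ ^ 2)) * (x ^ k * p x)
  have hG (k : ℕ) (y : ℝ) : HasDerivAt (G k) ((G (k + 1) y - y * G k y) / σ ^ 2) y := by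
    have hx (x : ℝ) : x ^ (k + 1) * p x = x * (x ^ k * p x) := by ring
    have hint := integrable_pow_mul_of_hasCompactSupport hp hp_supp (k + 1)
    simp only [G, hx] at hint ⊢
    exact hasDerivAt_integral_gaussian_mul hσ c
      (integrable_pow_mul_of_hasCompactSupport hp hp_supp k) hint y
  have hpG : pY = G 0 := by
    ext y
    simp [G, hpY, hφ]
  have hmG (k : ℕ) (hk : 1 ≤ k) : m k = fun y ↦ G k y / G 0 y := by
    ext y
    rw [hm k hk, hpG]
    congr 2 with x
    rw [hφ]
    ring
  have hne : G 0 y ≠ 0 := hpG ▸ (hpY_pos y).ne'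
  have hd := (hG k y).fun_div (hG 0 y) hne
  rw [← hmG k hk] at hd
  refine ⟨hd.differentiableAt, ?_⟩
  rw [hd.deriv, hmG (k + 1) (by lia), hmG 1 le_rfl, hmG k hk]
  field_simp
  ring
end

section
/- For every integer k ≥ 3, every y ∈ ℝ^d, and all indices i₁,…,i_{k+1} ∈ {1,…,d}, the partial derivative ∂[μ_k(y)]_{i₁,…,i_k}/∂y_{i_{k+1}} exists and the posterior central moment tensors satisfy the recursion [μ_{k+1}(y)]_{i₁,…,i_{k+1}} = σ² · ∂[μ_k(y)]_{i₁,…,i_k}/∂y_{i_{k+1}} + Σ_{j=1}^{k} [μ_{k−1}(y)]_{ℓ_j} · [μ₂(y)]_{i_j, i_{k+1}}, where ℓ_j = (i₁,…,i_{j−1}, i_{j+1},…,i_k) is the multi-index obtained by deleting the j-th index. -/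
open MeasureTheory Real

/-- A jointly continuous function is bounded, locally uniformly in the parameter, on the support
of a compactly supported function. -/
lemma exists_norm_mul_le_of_hasCompactSupport {X : Type*} [TopologicalSpace X] {p : X → ℝ}
    (hp : HasCompactSupport p) {F : ℝ → X → ℝ} (hF : Continuous (Function.uncurry F)) (t₀ : ℝ) :
    ∃ C, ∀ t ∈ Metric.ball t₀ 1, ∀ x, ‖F t x * p x‖ ≤ C * ‖p x‖ := by
  obtain ⟨C, hC⟩ := ((isCompact_closedBall t₀ 1).prod hp.isCompact).exists_bound_of_continuousOn
    hF.continuousOn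
  refine ⟨C, fun t ht x => ?_⟩
  by_cases hx : x ∈ tsupport p
  · rw [norm_mul]
    gcongr
    exact hC (t, x) ⟨Metric.ball_subset_closedBall ht, hx⟩
  · simp [image_eq_zero_of_notMem_tsupport hx]

section TiltedMean

variable {X : Type*} [MeasurableSpace X] {μ : Measure X} {p : X → ℝ}

/-- The mean of `g` under the density proportional to `w * p`. -/
noncomputable def tiltedMean (μ : Measure X) (p w g : X → ℝ) : ℝ :=
  (∫ x, g x * w x * p x ∂μ) / ∫ x, w x * p x ∂μ

lemma tiltedMean_const_mul (w g : X → ℝ) (a : ℝ) :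
    tiltedMean μ p w (fun x => a * g x) = a * tiltedMean μ p w g := by
  simp only [tiltedMean, mul_assoc, integral_const_mul, mul_div_assoc]

lemma tiltedMean_const {w : X → ℝ} (h : ∫ x, w x * p x ∂μ ≠ 0) (a : ℝ) :
    tiltedMean μ p w (fun _ => a) = a := by
  simp only [tiltedMean, mul_assoc, integral_const_mul]
  field_simp

variable [TopologicalSpace X] [OpensMeasurableSpace X]

lemma aestronglyMeasurable_mul_of_continuous_uncurry (hpi : Integrable p μ) {F : ℝ → X → ℝ}
    (hF : Continuous (Function.uncurry F)) (t : ℝ) :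
    AEStronglyMeasurable (fun x => F t x * p x) μ := by
  have h : Continuous (F t) := hF.comp (Continuous.prodMk_right t)
  exact (h.measurable.aestronglyMeasurable).mul hpi.aestronglyMeasurable

lemma integrable_mul_of_continuous_uncurry (hp : HasCompactSupport p) (hpi : Integrable p μ)
    {F : ℝ → X → ℝ} (hF : Continuous (Function.uncurry F)) (t : ℝ) :
    Integrable (fun x => F t x * p x) μ := by
  obtain ⟨C, hC⟩ := exists_norm_mul_le_of_hasCompactSupport hp hF t
  exact (hpi.norm.const_mul C).mono' (aestronglyMeasurable_mul_of_continuous_uncurry hpi hF t)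
    (.of_forall (hC t (Metric.mem_ball_self one_pos)))

lemma continuous_integral_mul (hp : HasCompactSupport p) (hpi : Integrable p μ)
    {F : ℝ → X → ℝ} (hF : Continuous (Function.uncurry F)) :
    Continuous fun t => ∫ x, F t x * p x ∂μ := by
  refine continuous_iff_continuousAt.2 fun t₀ => ?_
  obtain ⟨C, hC⟩ := exists_norm_mul_le_of_hasCompactSupport hp hF t₀
  refine continuousAt_of_dominated (bound := fun x => C * ‖p x‖)
    (.of_forall (aestronglyMeasurable_mul_of_continuous_uncurry hpi hF)) ?_
    (hpi.norm.const_mul C) (.of_forall fun x => ?_)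
  · filter_upwards [Metric.ball_mem_nhds t₀ one_pos] with t ht using .of_forall (hC t ht)
  · have h : Continuous fun t => F t x := hF.comp (Continuous.prodMk_left x)
    exact (h.mul continuous_const).continuousAt

lemma hasDerivAt_integral_mul (hp : HasCompactSupport p) (hpi : Integrable p μ)
    {F F' : ℝ → X → ℝ} (hF : Continuous (Function.uncurry F))
    (hF' : Continuous (Function.uncurry F')) (h : ∀ t x, HasDerivAt (F · x) (F' t x) t) (t : ℝ) :
    HasDerivAt (fun t => ∫ x, F t x * p x ∂μ) (∫ x, F' t x * p x ∂μ) t := by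
  obtain ⟨C, hC⟩ := exists_norm_mul_le_of_hasCompactSupport hp hF' t
  exact (hasDerivAt_integral_of_dominated_loc_of_deriv_le (bound := fun x => C * ‖p x‖)
    (Metric.ball_mem_nhds t one_pos)
    (.of_forall (aestronglyMeasurable_mul_of_continuous_uncurry hpi hF))
    (integrable_mul_of_continuous_uncurry hp hpi hF t)
    (aestronglyMeasurable_mul_of_continuous_uncurry hpi hF' t)
    (.of_forall fun x s hs => hC s hs x) (hpi.norm.const_mul C)
    (.of_forall fun x s _ => (h s x).mul_const (p x))).2

lemma tiltedMean_add (hp : HasCompactSupport p) (hpi : Integrable p μ) {w g h : X → ℝ}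
    (hw : Continuous w) (hg : Continuous g) (hh : Continuous h) :
    tiltedMean μ p w (fun x => g x + h x) = tiltedMean μ p w g + tiltedMean μ p w h := by
  have H {f : X → ℝ} (hf : Continuous f) : Integrable (fun x => f x * w x * p x) μ :=
    integrable_mul_of_continuous_uncurry (F := fun _ x => f x * w x) hp hpi (by fun_prop) 0
  simp only [tiltedMean, add_mul]
  rw [integral_add (H hg) (H hh), add_div]

lemma tiltedMean_sum (hp : HasCompactSupport p) (hpi : Integrable p μ) {ι : Type*}
    (s : Finset ι) {w : X → ℝ} {g : ι → X → ℝ} (hw : Continuous w) (hg : ∀ i, Continuous (g i)) :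
    tiltedMean μ p w (fun x => ∑ i ∈ s, g i x) = ∑ i ∈ s, tiltedMean μ p w (g i) := by
  have H (i : ι) : Integrable (fun x => g i x * w x * p x) μ :=
    integrable_mul_of_continuous_uncurry (F := fun _ x => g i x * w x) hp hpi
      (by have := hg i; fun_prop) 0
  simp only [tiltedMean, Finset.sum_mul]
  rw [integral_finsetSum _ fun i _ => H i, Finset.sum_div]

lemma continuous_tiltedMean (hp : HasCompactSupport p) (hpi : Integrable p μ)
    {w g : ℝ → X → ℝ} (hw : Continuous (Function.uncurry w))
    (hg : Continuous (Function.uncurry g)) (hpos : ∀ t, ∫ x, w t x * p x ∂μ ≠ 0) :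
    Continuous fun t => tiltedMean μ p (w t) (g t) :=
  (continuous_integral_mul (F := fun t x => g t x * w t x) hp hpi (hg.mul hw)).div
    (continuous_integral_mul hp hpi hw) hpos

/-- If the weight `w` has score `s`, then the derivative of the tilted mean of `g` is the tilted
mean of the derivative of `g` plus the tilted covariance of `g` and `s`. -/
lemma hasDerivAt_tiltedMean (hp : HasCompactSupport p) (hpi : Integrable p μ)
    {w s g g' : ℝ → X → ℝ} (hw : Continuous (Function.uncurry w))
    (hs : Continuous (Function.uncurry s)) (hg : Continuous (Function.uncurry g))
    (hg' : Continuous (Function.uncurry g'))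
    (hdw : ∀ t x, HasDerivAt (w · x) (s t x * w t x) t)
    (hdg : ∀ t x, HasDerivAt (g · x) (g' t x) t)
    (hpos : ∀ t, ∫ x, w t x * p x ∂μ ≠ 0) (t : ℝ) :
    HasDerivAt (fun t => tiltedMean μ p (w t) (g t))
      (tiltedMean μ p (w t) (g' t) + (tiltedMean μ p (w t) (fun x => g t x * s t x) -
        tiltedMean μ p (w t) (g t) * tiltedMean μ p (w t) (s t))) t := by
  have hN := hasDerivAt_integral_mul (F := fun t x => g t x * w t x)
    (F' := fun t x => (g' t x + g t x * s t x) * w t x) hp hpi (hg.mul hw)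
    ((hg'.add (hg.mul hs)).mul hw)
    (fun t x => ((hdg t x).mul (hdw t x)).congr_deriv (by ring)) t
  have hZ := hasDerivAt_integral_mul (F' := fun t x => s t x * w t x) hp hpi hw (hs.mul hw) hdw t
  refine (hN.div hZ (hpos t)).congr_deriv ?_
  have hc {f : ℝ → X → ℝ} (hf : Continuous (Function.uncurry f)) : Continuous (f t) :=
    hf.comp (Continuous.prodMk_right t)
  have hadd := tiltedMean_add hp hpi (h := fun x => g t x * s t x) (hc hw) (hc hg')
    ((hc hg).mul (hc hs))
  rw [← add_sub_assoc, ← hadd]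
  have := hpos t
  simp only [tiltedMean]
  field_simp

end TiltedMean

lemma prod_erase_eq_prod_succAbove {n : ℕ} (f : Fin (n + 1) → ℝ) (j : Fin (n + 1)) :
    ∏ i ∈ Finset.univ.erase j, f i = ∏ i, f (j.succAbove i) := by
  rw [← Finset.compl_singleton, ← Fin.image_succAbove_univ,
    Finset.prod_image Fin.succAbove_right_injective.injOn]

lemma hasDerivAt_gaussian_update {d : ℕ} (A σ : ℝ) (hσ : σ ≠ 0) (y x : Fin d → ℝ) (c : Fin d)
    (t : ℝ) :
    HasDerivAt
      (fun t => A * Real.exp (-(∑ i, (Function.update y c t - x) i ^ 2) / (2 * σ ^ 2)))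
      (((σ ^ 2)⁻¹ * (x c - t)) *
        (A * Real.exp (-(∑ i, (Function.update y c t - x) i ^ 2) / (2 * σ ^ 2)))) t := by
  have hsum : HasDerivAt (fun t => ∑ i, (Function.update y c t - x) i ^ 2) (2 * (t - x c)) t := by
    have hi (i : Fin d) : HasDerivAt (fun t => (Function.update y c t - x) i ^ 2)
        (if i = c then 2 * (t - x c) else 0) t := by
      by_cases h : i = c
      · subst h
        simpa using ((hasDerivAt_id' t).sub_const (x i)).fun_pow 2
      · simpa [h] using hasDerivAt_const t ((y i - x i) ^ 2)
    simpa using HasDerivAt.fun_sum fun i (_ : i ∈ Finset.univ) => hi i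
  refine (((hsum.fun_neg.div_const (2 * σ ^ 2)).exp).const_mul A).congr_deriv ?_
  field_simp
  ring

/-- **Recursion for posterior central moment tensors (multivariate).** For every `k ≥ 3`
(written `k = n + 1` with `n ≥ 2`), every `y` and all indices `i₁, …, i_{k+1}` (encoded as
`idx : Fin (k+1) → Fin d`, whose first `k` entries are `fun j => idx j.castSucc` and whose
last entry is `idx (Fin.last k)`), the partial derivative `∂(μ_k y)_{i₁,…,i_k}/∂y_{i_{k+1}}`
exists and
`(μ_{k+1} y)_{i₁,…,i_{k+1}} = σ² ∂(μ_k y)_{i₁,…,i_k}/∂y_{i_{k+1}}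
  + ∑_{j=1}^k (μ_{k-1} y)_{ℓ_j} (μ₂ y)_{i_j, i_{k+1}}`,
where `ℓ_j` deletes the `j`-th index (realized via `Fin.succAbove`). -/
theorem central_moment_tensor_recursion
    (d : ℕ) (hd : 1 ≤ d)
    (σ : ℝ) (hσ : 0 < σ)
    (p : (Fin d → ℝ) → ℝ) (hp_meas : Measurable p) (hp_nonneg : ∀ x, 0 ≤ p x)
    (hp_bdd : ∃ C, ∀ x, p x ≤ C) (hp_supp : HasCompactSupport p)
    (hp_int : ∫ x, p x = 1)
    (φ : (Fin d → ℝ) → ℝ)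
    (hφ : ∀ u, φ u = (2 * π * σ ^ 2) ^ (-(d : ℝ) / 2) *
      Real.exp (-(∑ i, u i ^ 2) / (2 * σ ^ 2)))
    (pY : (Fin d → ℝ) → ℝ) (hpY : ∀ y, pY y = ∫ x, φ (y - x) * p x)
    (hpY_pos : ∀ y, 0 < pY y)
    (μ₁ : (Fin d → ℝ) → Fin d → ℝ)
    (hμ₁ : ∀ y i, μ₁ y i = (∫ x, x i * φ (y - x) * p x) / pY y)
    (M : ∀ k : ℕ, (Fin d → ℝ) → (Fin k → Fin d) → ℝ)
    (hM : ∀ k : ℕ, 2 ≤ k → ∀ (y : Fin d → ℝ) (idx : Fin k → Fin d),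
      M k y idx = (∫ x, (∏ j, (x (idx j) - μ₁ y (idx j))) * φ (y - x) * p x) / pY y) :
    ∀ n : ℕ, 2 ≤ n → ∀ (y : Fin d → ℝ) (idx : Fin (n + 2) → Fin d),
      DifferentiableAt ℝ
        (fun t => M (n + 1) (Function.update y (idx (Fin.last (n + 1))) t)
          (fun j : Fin (n + 1) => idx j.castSucc))
        (y (idx (Fin.last (n + 1)))) ∧
      M (n + 2) y idx =
        σ ^ 2 * deriv
          (fun t => M (n + 1) (Function.update y (idx (Fin.last (n + 1))) t)
            (fun j : Fin (n + 1) => idx j.castSucc))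
          (y (idx (Fin.last (n + 1)))) +
        ∑ j : Fin (n + 1),
          M n y (fun j' : Fin n => idx (j.succAbove j').castSucc) *
          M 2 y ![idx j.castSucc, idx (Fin.last (n + 1))] := by
  have hφ' : φ = fun u => (2 * π * σ ^ 2) ^ (-(d : ℝ) / 2) *
      Real.exp (-(∑ i, u i ^ 2) / (2 * σ ^ 2)) := funext hφ
  generalize (2 * π * σ ^ 2) ^ (-(d : ℝ) / 2) = A at hφ'
  have hpi : Integrable p := .of_integral_ne_zero (by simp [hp_int])
  intro n hn y idx
  set c := idx (Fin.last (n + 1)) with hc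
  obtain ⟨w, hφw⟩ : ∃ w : ℝ → (Fin d → ℝ) → ℝ, ∀ t x, φ (Function.update y c t - x) = w t x :=
    ⟨_, fun _ _ => rfl⟩
  have hw_def : w = fun t x =>
      A * Real.exp (-(∑ i, (Function.update y c t - x) i ^ 2) / (2 * σ ^ 2)) := by
    funext t x
    rw [← hφw, hφ']
  have hw : Continuous (Function.uncurry w) := by
    simp only [hw_def, Function.uncurry_def, Pi.sub_apply]
    have hu (i : Fin d) : Continuous fun q : ℝ × (Fin d → ℝ) => Function.update y c q.1 i :=
      continuous_pi_iff.1 ((continuous_const (y := y)).update c continuous_fst) i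
    fun_prop
  have hwt (t : ℝ) : Continuous (w t) := hw.comp (Continuous.prodMk_right t)
  have hpos (t : ℝ) : ∫ x, w t x * p x ≠ 0 := by
    have := (hpY_pos (Function.update y c t)).ne'
    simpa only [hpY, hφw] using this
  have hdw (t : ℝ) (x : Fin d → ℝ) : HasDerivAt (w · x) (((σ ^ 2)⁻¹ * (x c - t)) * w t x) t := by
    simp only [hw_def]
    exact hasDerivAt_gaussian_update A σ hσ.ne' y x c t
  obtain ⟨E, hE⟩ : ∃ E : ℝ → ((Fin d → ℝ) → ℝ) → ℝ, E = fun t g => tiltedMean volume p (w t) g :=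
    ⟨_, rfl⟩
  obtain ⟨m, hm_def⟩ : ∃ m : ℝ → Fin d → ℝ, ∀ t, μ₁ (Function.update y c t) = m t :=
    ⟨_, fun _ => rfl⟩
  have hm (t : ℝ) (i : Fin d) : m t i = E t fun x => x i := by
    simp only [← hm_def, hE, hμ₁, hpY, tiltedMean, hφw]
  have hME (k : ℕ) (hk : 2 ≤ k) (t : ℝ) (a : Fin k → Fin d) :
      M k (Function.update y c t) a = E t fun x => ∏ j, (x (a j) - m t (a j)) := by
    simp only [hM k hk, hpY, hφw, hm_def, hE, tiltedMean]
  have hcenter (t : ℝ) : E t (fun x => x c - m t c) = 0 := by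
    simp only [sub_eq_add_neg, hE]
    rw [tiltedMean_add hp_supp hpi (hwt t) (by fun_prop) (by fun_prop), tiltedMean_const (hpos t),
      hm t c]
    simp only [hE, add_neg_cancel]
  -- The score of the Gaussian weight turns the derivative into a covariance with `x c`.
  have key (g g' : ℝ → (Fin d → ℝ) → ℝ) (hg : Continuous (Function.uncurry g))
      (hg' : Continuous (Function.uncurry g')) (hdg : ∀ t x, HasDerivAt (g · x) (g' t x) t)
      (t : ℝ) : HasDerivAt (fun t => E t (g t))
        (E t (g' t) + (σ ^ 2)⁻¹ * E t (fun x => g t x * (x c - m t c))) t := by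
    have hgt : Continuous (g t) := hg.comp (Continuous.prodMk_right t)
    have hder := (hasDerivAt_tiltedMean (s := fun t x => (σ ^ 2)⁻¹ * (x c - t)) hp_supp hpi hw
      (by simp only [Function.uncurry_def]; fun_prop) hg hg'
      hdw hdg hpos t)
    have h₁ : (fun x : Fin d → ℝ => g t x * ((σ ^ 2)⁻¹ * (x c - t))) =
        fun x => (σ ^ 2)⁻¹ * (g t x * (x c - m t c)) + ((σ ^ 2)⁻¹ * (m t c - t)) * g t x := by
      funext x; ring
    have h₂ : (fun x : Fin d → ℝ => (σ ^ 2)⁻¹ * (x c - t)) =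
        fun x => (σ ^ 2)⁻¹ * (x c - m t c) + (σ ^ 2)⁻¹ * (m t c - t) := by
      funext x; ring
    have h₃ := hcenter t
    simp only [hE] at h₃ ⊢
    refine hder.congr_deriv ?_
    rw [h₁, h₂, tiltedMean_add hp_supp hpi (hwt t) (by fun_prop) (by fun_prop),
      tiltedMean_add hp_supp hpi (hwt t) (by fun_prop) (by fun_prop), tiltedMean_const (hpos t),
      tiltedMean_const_mul, tiltedMean_const_mul, tiltedMean_const_mul, h₃]
    ring
  have hmc (i : Fin d) : Continuous fun t => m t i := by
    simp only [hm, hE]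
    exact continuous_tiltedMean (g := fun _ x => x i) hp_supp hpi hw
      (by simp only [Function.uncurry_def]; fun_prop) hpos
  obtain ⟨m', hm'⟩ : ∃ m' : ℝ → Fin d → ℝ,
      m' = fun t i => (σ ^ 2)⁻¹ * E t (fun x => x i * (x c - m t c)) := ⟨_, rfl⟩
  have hm'c (i : Fin d) : Continuous fun t => m' t i := by
    simp only [hm', hE]
    refine continuous_const.mul (continuous_tiltedMean (g := fun t x => x i * (x c - m t c))
      hp_supp hpi hw ?_ hpos)
    have := hmc c
    simp only [Function.uncurry_def]
    fun_prop
  have hdm (i : Fin d) (t : ℝ) : HasDerivAt (fun t => m t i) (m' t i) t := by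
    simp only [hm _ i]
    refine (key (fun _ x => x i) (fun _ _ => 0) (by simp only [Function.uncurry_def]; fun_prop)
      (by simp only [Function.uncurry_def]; fun_prop) (fun t x => hasDerivAt_const t (x i))
      t).congr_deriv ?_
    have h₀ : E t (fun _ => 0) = 0 := by
      rw [hE]
      exact tiltedMean_const (hpos t) 0
    rw [h₀, zero_add, hm']
  have hm'M (t : ℝ) (i : Fin d) :
      m' t i = (σ ^ 2)⁻¹ * M 2 (Function.update y c t) ![i, c] := by
    rw [hME 2 le_rfl]
    have h₁ : (fun x : Fin d → ℝ => x i * (x c - m t c)) = fun x =>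
        (∏ j, (x (![i, c] j) - m t (![i, c] j))) + m t i * (x c - m t c) := by
      funext x
      simp only [Fin.prod_univ_two, Matrix.cons_val_zero, Matrix.cons_val_one]
      ring
    have h₃ := hcenter t
    simp only [hm', hE] at h₃ ⊢
    rw [h₁, tiltedMean_add hp_supp hpi (hwt t) (by fun_prop) (by fun_prop), tiltedMean_const_mul,
      h₃, mul_zero, add_zero]
  have hderiv := key (fun t x => ∏ j : Fin (n + 1), (x (idx j.castSucc) - m t (idx j.castSucc)))
    (fun t x => ∑ j : Fin (n + 1), -m' t (idx j.castSucc) * ∏ l : Fin n,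
      (x (idx (j.succAbove l).castSucc) - m t (idx (j.succAbove l).castSucc)))
    (by simp only [Function.uncurry_def]; fun_prop)
    (by simp only [Function.uncurry_def]; fun_prop)
    (fun t x => (HasDerivAt.fun_finsetProd fun j _ =>
      (hdm (idx j.castSucc) t).const_sub (x (idx j.castSucc))).congr_deriv <|
        Finset.sum_congr rfl fun j _ => by
          rw [prod_erase_eq_prod_succAbove (fun i => x (idx i.castSucc) - m t (idx i.castSucc)),
            smul_eq_mul, mul_comm])
    (y c)
  simp only [← hME (n + 1) (by lia) _ (fun j : Fin (n + 1) => idx j.castSucc)] at hderiv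
  refine ⟨hderiv.differentiableAt, ?_⟩
  have hMn (k : ℕ) (hk : 2 ≤ k) (a : Fin k → Fin d) :
      M k y a = E (y c) fun x => ∏ j, (x (a j) - m (y c) (a j)) := by
    simpa using hME k hk (y c) a
  have hsum : E (y c) (fun x => ∑ j : Fin (n + 1), -m' (y c) (idx j.castSucc) * ∏ l : Fin n,
      (x (idx (j.succAbove l).castSucc) - m (y c) (idx (j.succAbove l).castSucc))) =
      -(σ ^ 2)⁻¹ * ∑ j : Fin (n + 1), M n y (fun l : Fin n => idx (j.succAbove l).castSucc) *
        M 2 y ![idx j.castSucc, c] := by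
    simp only [hE]
    rw [tiltedMean_sum hp_supp hpi _ (hwt _) (fun j => by fun_prop), Finset.mul_sum]
    refine Finset.sum_congr rfl fun j _ => ?_
    rw [tiltedMean_const_mul, hm'M, Function.update_eq_self, hMn n hn, hE]
    ring
  rw [hderiv.deriv, hsum, hMn (n + 2) (by lia)]
  simp only [Fin.prod_univ_castSucc (n := n + 1), ← hc]
  field_simp
  ring
end

section
/- Let v ∈ ℝ^d be a fixed vector. For every y ∈ ℝ^d, the directional derivative D_v μ₂^v(y) exists and the third directional posterior central moment satisfies μ₃^v(y) = σ² · D_v μ₂^v(y). -/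
open MeasureTheory Real

/-- A continuous function times an integrable compactly supported function is integrable. -/
lemma Continuous.integrable_mul_of_hasCompactSupport {X : Type*} [TopologicalSpace X]
    [T2Space X] [MeasurableSpace X] [OpensMeasurableSpace X] {μ : Measure X} {g p : X → ℝ}
    (hg : Continuous g) (hp : Integrable p μ) (hp_supp : HasCompactSupport p) :
    Integrable (fun x => g x * p x) μ := by
  have h : IntegrableOn (fun x => g x * p x) (tsupport p) μ :=
    hp.integrableOn.continuousOn_mul hg.continuousOn hp_supp
  refine (integrableOn_iff_integrable_of_support_subset ?_).1 h
  exact (Function.support_mul_subset_right g p).trans (subset_tsupport p)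

/-- Derivative of the isotropic Gaussian kernel along a line. -/
lemma hasDerivAt_gaussian_line {ι : Type*} [Fintype ι] {σ K : ℝ} (hσ : σ ≠ 0) (v y x : ι → ℝ)
    (t : ℝ) :
    HasDerivAt (fun t : ℝ => K * Real.exp (-(∑ i, (y + t • v - x) i ^ 2) / (2 * σ ^ 2)))
      ((∑ i, v i * x i - ∑ i, v i * y i - t * ∑ i, v i ^ 2) / σ ^ 2 *
        (K * Real.exp (-(∑ i, (y + t • v - x) i ^ 2) / (2 * σ ^ 2)))) t := by
  have h1 : ∀ i, HasDerivAt (fun t : ℝ => (y + t • v - x) i ^ 2)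
      (2 * (y i + t * v i - x i) * v i) t := by
    intro i
    have h := ((((hasDerivAt_id t).mul_const (v i)).const_add (y i)).sub_const (x i)).fun_pow 2
    simpa using h
  have h2 := (((HasDerivAt.fun_sum (u := Finset.univ) fun i _ => h1 i).neg.div_const
    (2 * σ ^ 2)).exp).const_mul K
  refine h2.congr_deriv ?_
  have h3 : ∑ i, 2 * (y i + t * v i - x i) * v i
      = -2 * (∑ i, v i * x i - ∑ i, v i * y i - t * ∑ i, v i ^ 2) := by
    rw [Finset.mul_sum, ← Finset.sum_sub_distrib, ← Finset.sum_sub_distrib, Finset.mul_sum]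
    exact Finset.sum_congr rfl fun i _ => by ring
  rw [h3]
  simp only [Pi.neg_apply]
  field_simp

/-- Differentiation under the integral sign for the Gaussian convolution of a compactly supported
density weighted by a continuous function. -/
lemma hasDerivAt_integral_gaussian {ι : Type*} [Fintype ι] {σ K : ℝ} (hσ : σ ≠ 0)
    {p g φ : (ι → ℝ) → ℝ} (hp : Integrable p) (hp_supp : HasCompactSupport p)
    (hg : Continuous g)
    (hφ : ∀ u, φ u = K * Real.exp (-(∑ i, u i ^ 2) / (2 * σ ^ 2))) (v y : ι → ℝ) :
    HasDerivAt (fun t : ℝ => ∫ x, g x * φ (y + t • v - x) * p x)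
      (((∫ x, ((∑ i, v i * x i) * g x) * φ (y - x) * p x) -
        (∑ i, v i * y i) * ∫ x, g x * φ (y - x) * p x) / σ ^ 2) 0 := by
  obtain rfl : φ = fun u => K * Real.exp (-(∑ i, u i ^ 2) / (2 * σ ^ 2)) := funext hφ
  set ψ : (ι → ℝ) → ℝ := fun u => K * Real.exp (-(∑ i, u i ^ 2) / (2 * σ ^ 2)) with hψ
  have hψc : Continuous ψ := by fun_prop
  have hψb : ∀ u, |ψ u| ≤ |K| := by
    intro u
    rw [hψ, abs_mul, Real.abs_exp]
    refine mul_le_of_le_one_right (abs_nonneg K) (Real.exp_le_one_iff.2 ?_)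
    exact div_nonpos_of_nonpos_of_nonneg
      (neg_nonpos.2 (Finset.sum_nonneg fun i _ => sq_nonneg _)) (by positivity)
  have hint : ∀ f : (ι → ℝ) → ℝ, Continuous f → Integrable fun x => f x * p x :=
    fun f hf => hf.integrable_mul_of_hasCompactSupport hp hp_supp
  set F' : ℝ → (ι → ℝ) → ℝ := fun t x =>
    g x * ((∑ i, v i * x i - ∑ i, v i * y i - t * ∑ i, v i ^ 2) / σ ^ 2 *
      ψ (y + t • v - x)) * p x with hF'
  set bound : (ι → ℝ) → ℝ := fun x =>
    |g x| * ((|∑ i, v i * x i - ∑ i, v i * y i| + |∑ i, v i ^ 2|) / σ ^ 2 * |K|) * |p x|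
  have hbound : Integrable bound := by
    have hc : Continuous fun x : ι → ℝ =>
        |g x| * ((|∑ i, v i * x i - ∑ i, v i * y i| + |∑ i, v i ^ 2|) / σ ^ 2 * |K|) := by
      fun_prop
    exact hc.integrable_mul_of_hasCompactSupport hp.abs hp_supp.abs
  have key := (hasDerivAt_integral_of_dominated_loc_of_deriv_le (μ := volume) (x₀ := (0 : ℝ))
    (F := fun t x => g x * ψ (y + t • v - x) * p x) (F' := F') (bound := bound)
    (Metric.ball_mem_nhds 0 one_pos)
    (.of_forall fun t => (hint _ (by fun_prop)).aestronglyMeasurable)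
    (hint _ (by fun_prop)) (hint _ (by fun_prop)).aestronglyMeasurable
    (.of_forall fun x t ht => ?_) hbound
    (.of_forall fun x t _ =>
      (((hasDerivAt_gaussian_line hσ v y x t).const_mul (g x)).mul_const (p x)))).2
  · refine key.congr_deriv ?_
    rw [← integral_const_mul, ← integral_sub, ← integral_div]
    · refine integral_congr_ae (.of_forall fun x => ?_)
      simp only [hF', zero_smul, add_zero, zero_mul, sub_zero]
      ring
    · exact hint _ (by fun_prop)
    · exact (hint _ (by fun_prop)).const_mul _
  · have ht' : |t| ≤ 1 := by simpa using (mem_ball_zero_iff.1 ht).le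
    simp only [hF', bound, Real.norm_eq_abs, abs_mul, abs_div, abs_pow, sq_abs]
    gcongr |g x| * (?_ / σ ^ 2 * ?_) * |p x|
    · refine (abs_sub _ _).trans ?_
      rw [abs_mul]
      gcongr
      exact mul_le_of_le_one_left (abs_nonneg _) ht'
    · exact hψb _

/-- **Third directional posterior moment via directional derivative.** For a fixed `v` and
every `y`, the directional derivative `D_v μ₂^v(y)` exists and `μ₃^v(y) = σ² D_v μ₂^v(y)`. -/
theorem third_directional_moment
    (d : ℕ) (hd : 1 ≤ d)
    (σ : ℝ) (hσ : 0 < σ)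
    (p : (Fin d → ℝ) → ℝ) (hp_meas : Measurable p) (hp_nonneg : ∀ x, 0 ≤ p x)
    (hp_bdd : ∃ C, ∀ x, p x ≤ C) (hp_supp : HasCompactSupport p)
    (hp_int : ∫ x, p x = 1)
    (φ : (Fin d → ℝ) → ℝ)
    (hφ : ∀ u, φ u = (2 * π * σ ^ 2) ^ (-(d : ℝ) / 2) *
      Real.exp (-(∑ i, u i ^ 2) / (2 * σ ^ 2)))
    (pY : (Fin d → ℝ) → ℝ) (hpY : ∀ y, pY y = ∫ x, φ (y - x) * p x)
    (hpY_pos : ∀ y, 0 < pY y)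
    (μ₁ : (Fin d → ℝ) → Fin d → ℝ)
    (hμ₁ : ∀ y i, μ₁ y i = (∫ x, x i * φ (y - x) * p x) / pY y)
    (v : Fin d → ℝ)
    (μv : ℕ → (Fin d → ℝ) → ℝ)
    (hμv : ∀ k : ℕ, 2 ≤ k → ∀ y : Fin d → ℝ,
      μv k y = (∫ x, (∑ i, v i * (x i - μ₁ y i)) ^ k * φ (y - x) * p x) / pY y)
    (y : Fin d → ℝ) :
    DifferentiableAt ℝ (fun t : ℝ => μv 2 (y + t • v)) 0 ∧
    μv 3 y = σ ^ 2 * deriv (fun t : ℝ => μv 2 (y + t • v)) 0 := by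
  have hp : Integrable p := .of_integral_ne_zero (by rw [hp_int]; exact one_ne_zero)
  have hφc : Continuous φ := by
    rw [funext hφ]
    fun_prop
  set s : (Fin d → ℝ) → ℝ := fun x => ∑ i, v i * x i with hs
  have hsc : Continuous s := by fun_prop
  set M : ℕ → (Fin d → ℝ) → ℝ := fun k z => ∫ x, s x ^ k * φ (z - x) * p x with hM
  have hint : ∀ k z, Integrable fun x => s x ^ k * φ (z - x) * p x := fun k z =>
    (Continuous.integrable_mul_of_hasCompactSupport (by fun_prop) hp hp_supp)
  have hM0 : ∀ z, pY z = M 0 z := fun z => by simp [hpY, hM]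
  have hM0' : ∀ z, M 0 z ≠ 0 := fun z => hM0 z ▸ (hpY_pos z).ne'
  have hmean : ∀ z, ∑ i, v i * μ₁ z i = M 1 z / M 0 z := by
    intro z
    simp only [hμ₁, hM0, ← mul_div_assoc, ← Finset.sum_div, ← integral_const_mul]
    rw [← integral_finsetSum]
    · congr 1
      refine integral_congr_ae (.of_forall fun x => ?_)
      simp only [hs, pow_one, Finset.sum_mul]
      exact Finset.sum_congr rfl fun i _ => by ring
    · exact fun i _ => (Continuous.integrable_mul_of_hasCompactSupport
        (g := fun x => x i * φ (z - x)) (by fun_prop) hp hp_supp).const_mul _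
  have hcenter : ∀ z x, ∑ i, v i * (x i - μ₁ z i) = s x - M 1 z / M 0 z := by
    intro z x
    simp only [mul_sub, Finset.sum_sub_distrib, hmean, hs]
  have hcubic : ∀ (c : Fin 4 → ℝ) z, ∫ x, (∑ k, c k * s x ^ (k : ℕ)) * φ (z - x) * p x
      = ∑ k, c k * M k z := by
    intro c z
    simp only [hM, ← integral_const_mul]
    rw [← integral_finsetSum _ fun (k : Fin 4) _ => (hint k z).const_mul (c k)]
    refine integral_congr_ae (.of_forall fun x => ?_)
    simp only [Finset.sum_mul, mul_assoc]
  have hμ2 : ∀ z, μv 2 z = M 2 z / M 0 z - (M 1 z / M 0 z) ^ 2 := by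
    intro z
    rw [hμv 2 le_rfl, hM0]
    simp only [hcenter]
    set m := M 1 z / M 0 z with hm
    have h : ∫ x, (s x - m) ^ 2 * φ (z - x) * p x
        = M 2 z - 2 * m * M 1 z + m ^ 2 * M 0 z := by
      convert hcubic ![m ^ 2, -2 * m, 1, 0] z using 1
      · refine integral_congr_ae (.of_forall fun x => ?_)
        dsimp only
        congr 2
        simp [Fin.sum_univ_four]
        ring
      · simp [Fin.sum_univ_four]
        ring
    rw [h, hm]
    have := hM0' z
    field_simp
    ring
  have hμ3 : μv 3 y = M 3 y / M 0 y - 3 * (M 1 y / M 0 y) * (M 2 y / M 0 y)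
      + 2 * (M 1 y / M 0 y) ^ 3 := by
    rw [hμv 3 (by norm_num), hM0]
    simp only [hcenter]
    set m := M 1 y / M 0 y with hm
    have h : ∫ x, (s x - m) ^ 3 * φ (y - x) * p x
        = M 3 y - 3 * m * M 2 y + 3 * m ^ 2 * M 1 y - m ^ 3 * M 0 y := by
      convert hcubic ![-m ^ 3, 3 * m ^ 2, -3 * m, 1] y using 1
      · refine integral_congr_ae (.of_forall fun x => ?_)
        dsimp only
        congr 2
        simp [Fin.sum_univ_four]
        ring
      · simp [Fin.sum_univ_four]
        ring
    rw [h, hm]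
    have := hM0' y
    field_simp
    ring
  have hderiv : ∀ k, HasDerivAt (fun t : ℝ => M k (y + t • v))
      ((M (k + 1) y - s y * M k y) / σ ^ 2) 0 := by
    intro k
    have h := hasDerivAt_integral_gaussian hσ.ne' hp hp_supp (g := fun x => s x ^ k)
      (by fun_prop) hφ v y
    simpa only [hM, hs, pow_succ'] using h
  have hy : y + (0 : ℝ) • v = y := by simp
  have hquot : ∀ k, HasDerivAt (fun t : ℝ => M k (y + t • v) / M 0 (y + t • v))
      ((M (k + 1) y * M 0 y - M k y * M 1 y) / (σ ^ 2 * M 0 y ^ 2)) 0 := by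
    intro k
    refine ((hderiv k).fun_div (hderiv 0) (by rw [hy]; exact hM0' y)).congr_deriv ?_
    have := hM0' y
    rw [hy, zero_add]
    field_simp
    ring
  have hD : HasDerivAt (fun t : ℝ => μv 2 (y + t • v)) (μv 3 y / σ ^ 2) 0 := by
    simp only [hμ2]
    refine ((hquot 2).fun_sub ((hquot 1).fun_pow 2)).congr_deriv ?_
    have := hM0' y
    rw [hμ3, hy, Nat.add_one_sub_one, pow_one, Nat.cast_ofNat]
    field_simp
    ring
  refine ⟨hD.differentiableAt, ?_⟩
  rw [hD.deriv]
  field_simp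
end
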